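/- arXiv:2002.05308 — 2 statements merged into one kernel-verified Lean document; each statement's English description precedes it below -/
import Mathlib

section
/- Let X be a random variable with values in a measurable space 𝒳 and let a, b : 𝒳 → ℝ be measurable with a(x) > 0 and b(x) > 0 for all x. Define q*(x) = √(a(x))/(√(a(x)) + √(b(x))). Then for every measurable q : 𝒳 → (0,1), E[a(X)/q(X) + b(X)/(1 − q(X))] ≥ E[a(X)/q*(X) + b(X)/(1 − q*(X))] = E[(√(a(X)) + √(b(X)))²], where the expectations are interpreted as Lebesgue integrals of nonnegative functions (possibly infinite). Hence q* minimizes the functional q ↦ E[a(X)/q(X) + b(X)/(1 − q(X))] over measurable maps q : 𝒳 → (0,1). -/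
open MeasureTheory

/-- Two-term Cauchy–Schwarz (Sedrakyan) inequality with weights summing to one. -/
lemma add_sq_le_sq_div_add_sq_div_one_sub (s t : ℝ) {p : ℝ} (hp0 : 0 < p) (hp1 : p < 1) :
    (s + t) ^ 2 ≤ s ^ 2 / p + t ^ 2 / (1 - p) := by
  have hp1' : 0 < 1 - p := sub_pos.2 hp1
  rw [div_add_div _ _ hp0.ne' hp1'.ne', le_div_iff₀ (mul_pos hp0 hp1')]
  linarith [sq_nonneg (s * (1 - p) - t * p)]

/-- Equality case of `add_sq_le_sq_div_add_sq_div_one_sub`. -/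
lemma sq_div_add_sq_div_one_sub_eq_add_sq {s t : ℝ} (hs : 0 < s) (ht : 0 < t) :
    s ^ 2 / (s / (s + t)) + t ^ 2 / (1 - s / (s + t)) = (s + t) ^ 2 := by
  have hst : s + t ≠ 0 := (add_pos hs ht).ne'
  have h : 1 - s / (s + t) = t / (s + t) := by
    field_simp
    ring
  rw [h]
  field_simp

/-- Proposition 1 (Efficient Probability of Assigning an Action), integrated form.
Let `X ~ μ` on `𝒳`, `a b : 𝒳 → ℝ` measurable and positive, and let
`q*(x) = √(a x)/(√(a x) + √(b x))`.  Then for every measurable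
`q : 𝒳 → (0,1)`,
`E[a(X)/q(X) + b(X)/(1 - q(X))] ≥ E[a(X)/q*(X) + b(X)/(1 - q*(X))]
  = E[(√(a X) + √(b X))²]`,
the expectations being Lebesgue integrals of nonnegative functions (possibly `∞`). -/
theorem efficient_policy_minimizes_expected_variance
    {𝒳 : Type*} [MeasurableSpace 𝒳] (μ : Measure 𝒳) [IsProbabilityMeasure μ]
    (a b : 𝒳 → ℝ) (ha_meas : Measurable a) (hb_meas : Measurable b)
    (ha_pos : ∀ x, 0 < a x) (hb_pos : ∀ x, 0 < b x)
    (qstar : 𝒳 → ℝ)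
    (hqstar : ∀ x, qstar x = Real.sqrt (a x) / (Real.sqrt (a x) + Real.sqrt (b x)))
    (q : 𝒳 → ℝ) (hq_meas : Measurable q) (hq : ∀ x, q x ∈ Set.Ioo (0 : ℝ) 1) :
    (∫⁻ x, ENNReal.ofReal (a x / qstar x + b x / (1 - qstar x)) ∂μ) ≤
      ∫⁻ x, ENNReal.ofReal (a x / q x + b x / (1 - q x)) ∂μ ∧
    (∫⁻ x, ENNReal.ofReal (a x / qstar x + b x / (1 - qstar x)) ∂μ) =
      ∫⁻ x, ENNReal.ofReal ((Real.sqrt (a x) + Real.sqrt (b x)) ^ 2) ∂μ := by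
  have h_opt (x : 𝒳) : a x / qstar x + b x / (1 - qstar x) = (√(a x) + √(b x)) ^ 2 := by
    have h := sq_div_add_sq_div_one_sub_eq_add_sq
      (Real.sqrt_pos.2 (ha_pos x)) (Real.sqrt_pos.2 (hb_pos x))
    rwa [← hqstar, Real.sq_sqrt (ha_pos x).le, Real.sq_sqrt (hb_pos x).le] at h
  have h_le (x : 𝒳) : (√(a x) + √(b x)) ^ 2 ≤ a x / q x + b x / (1 - q x) := by
    have h := add_sq_le_sq_div_add_sq_div_one_sub (√(a x)) (√(b x)) (hq x).1 (hq x).2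
    rwa [Real.sq_sqrt (ha_pos x).le, Real.sq_sqrt (hb_pos x).le] at h
  simp only [h_opt, and_true]
  exact lintegral_mono fun x => ENNReal.ofReal_le_ofReal (h_le x)
end

section
/- Suppose b1, b2, c are positive real constants and r is a positive real number with e⁴·r/4 > e and e⁴·c/2 > e (so the iterated logarithms below are positive), satisfying r ≥ 8·max( e⁴·b1·log log(e⁴·r/4), e⁴·b2 ) and r − √( b1·e⁴·r·log log(e⁴·r/4) + b2·e⁴·r ) − c ≤ 0. Then √r ≤ √( b1·e⁴·log log(e⁴·c/2) + b2·e⁴ ) + √c. -/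
/-- Modified Lemma 9 of Balsubramani (2014).  Here `e = exp 1` and `log log`
is the iterated natural logarithm. -/
theorem sqrt_bound_of_implicit_ineq (b1 b2 c r : ℝ)
    (hb1 : 0 < b1) (hb2 : 0 < b2) (hc : 0 < c) (hr : 0 < r)
    (hrr : Real.exp 1 < Real.exp 1 ^ 4 * r / 4)
    (hcc : Real.exp 1 < Real.exp 1 ^ 4 * c / 2)
    (hgrow : r ≥ 8 * max (Real.exp 1 ^ 4 * b1 *
        Real.log (Real.log (Real.exp 1 ^ 4 * r / 4))) (Real.exp 1 ^ 4 * b2))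
    (himp : r - Real.sqrt (b1 * Real.exp 1 ^ 4 * r *
          Real.log (Real.log (Real.exp 1 ^ 4 * r / 4)) + b2 * Real.exp 1 ^ 4 * r)
        - c ≤ 0) :
    Real.sqrt r ≤
      Real.sqrt (b1 * Real.exp 1 ^ 4 * Real.log (Real.log (Real.exp 1 ^ 4 * c / 2))
          + b2 * Real.exp 1 ^ 4) + Real.sqrt c := by
  set E := Real.exp 1 ^ 4
  have hE0 : 0 < E := by positivity
  set L := Real.log (Real.log (E * r / 4))
  set M := Real.log (Real.log (E * c / 2))
  have hlog : 1 < Real.log (E * r / 4) :=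
    (Real.lt_log_iff_exp_lt (by positivity)).2 hrr
  have hA : 8 * (E * b1 * L) ≤ r := le_trans (by gcongr; exact le_max_left _ _) hgrow
  have hB : 8 * (E * b2) ≤ r := le_trans (by gcongr; exact le_max_right _ _) hgrow
  have hhalf : Real.sqrt (b1 * E * r * L + b2 * E * r) ≤ r / 2 := by
    rw [Real.sqrt_le_left (by positivity)]
    nlinarith [mul_le_mul_of_nonneg_left hA hr.le, mul_le_mul_of_nonneg_left hB hr.le]
  have hLM : L ≤ M := by
    apply Real.log_le_log (by linarith)
    apply Real.log_le_log (by positivity)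
    nlinarith
  have hsqrt : Real.sqrt (b1 * E * r * L + b2 * E * r) ≤
      Real.sqrt r * Real.sqrt (b1 * E * M + b2 * E) := by
    rw [← Real.sqrt_mul hr.le]
    apply Real.sqrt_le_sqrt
    have := mul_le_mul_of_nonneg_left hLM (by positivity : 0 ≤ b1 * E * r)
    linarith
  have hd := Real.sqrt_nonneg (b1 * E * M + b2 * E)
  have hq := Real.sqrt_pos.2 hc
  by_contra! hlt
  nlinarith [Real.sq_sqrt hr.le, Real.sq_sqrt hc.le,
    mul_lt_mul'' hlt (lt_sub_iff_add_lt'.2 hlt) (by positivity) hq.le, mul_nonneg hd hq.le]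
end
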